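/- Let G be a countable group and μ a probability measure on G with finite entropy H(μ). Let τ be a Markov stopping time for the random walk (G,μ), finite almost everywhere, with finite expectation E(τ). Denote by μ_{τ∧n} the distribution of x_{τ∧n}. Then H(μ_{τ∧n}) → H(μ_τ) as n → ∞. -/

import Mathlib

open MeasureTheory Filter Real Topology ENNReal

/-- Position of the random walk after `n` steps: `x n = h 1 ⋯ h n`, where `h : ℕ → G` is the
sequence of increments (`h i` being the `(i+1)`-st increment); `x 0 = e`. -/
def rwPos {G : Type*} [Group G] (h : ℕ → G) (n : ℕ) : G :=
  ((List.range n).map h).prod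

/-- Convolution of two (sub-probability) densities on `G`: `(f * g)(x) = ∑_h f(h) g(h⁻¹ x)`. -/
noncomputable def fconv {G : Type*} [Group G] (f g : G → ℝ≥0∞) : G → ℝ≥0∞ :=
  fun x => ∑' h : G, f h * g (h⁻¹ * x)

open scoped Classical in
/-- `n`-fold convolution power of a density, with `f^{*0} = δ_e`. -/
noncomputable def fconvPow {G : Type*} [Group G] (f : G → ℝ≥0∞) : ℕ → G → ℝ≥0∞
  | 0 => fun x => if x = 1 then 1 else 0
  | n + 1 => fconv (fconvPow f n) f

/-- Entropy of a (sub-)probability density on a countable group: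
`H(f) = -∑_g f(g) log f(g)`. -/
noncomputable def fent {G : Type*} (f : G → ℝ≥0∞) : ℝ :=
  -∑' g : G, (f g).toReal * Real.log (f g).toReal

/-- The σ-algebra `𝒜₀ˢ` generated by the positions `x 0, …, x s` of the random walk. -/
def posSigma (G : Type*) [Group G] [MeasurableSpace G] (s : ℕ) :
    MeasurableSpace (ℕ → G) :=
  MeasurableSpace.comap (fun ω (i : Fin (s + 1)) => rwPos ω (i : ℕ)) inferInstance

/-- A Markov stopping time for the random walk: for every `s`, the set `{τ = s}` is measurable
with respect to the σ-algebra generated by the positions of the walk up to time `s`. -/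
def IsMST {G : Type*} [Group G] [MeasurableSpace G] (τ : (ℕ → G) → ℕ) : Prop :=
  ∀ s : ℕ, MeasurableSet[posSigma G s] {ω | τ ω = s}

/-- The information content `-log t` of an event of probability `t`, as an extended
nonnegative real; it is `∞` at `t = 0`. -/
noncomputable def infoContent (t : ℝ≥0∞) : ℝ≥0∞ :=
  (-(ENNReal.log t)).toENNReal

lemma infoContent_anti : Antitone infoContent := fun _ _ h =>
  EReal.toENNReal_le_toENNReal (EReal.neg_le_neg_iff.2 (ENNReal.log_monotone h))

lemma infoContent_eq {t : ℝ≥0∞} (h0 : t ≠ 0) (ht : t ≠ ∞) :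
    infoContent t = ENNReal.ofReal (-Real.log t.toReal) := by
  rw [infoContent, ENNReal.log_pos_real h0 ht, ← EReal.coe_neg, EReal.toENNReal_of_ne_top (by simp)]
  simp

lemma infoContent_mul_le {a b : ℝ≥0∞} (ha : a ≠ ∞) (hb : b ≠ ∞) :
    infoContent (a * b) ≤ infoContent a + infoContent b := by
  rcases eq_or_ne a 0 with rfl | ha0
  · simp [infoContent]
  rcases eq_or_ne b 0 with rfl | hb0
  · simp [infoContent]
  rw [infoContent_eq (mul_ne_zero ha0 hb0) (ENNReal.mul_ne_top ha hb), infoContent_eq ha0 ha,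
    infoContent_eq hb0 hb, ENNReal.toReal_mul,
    Real.log_mul (ENNReal.toReal_ne_zero.2 ⟨ha0, ha⟩) (ENNReal.toReal_ne_zero.2 ⟨hb0, hb⟩), neg_add]
  exact ENNReal.ofReal_add_le

lemma infoContent_prod_le (f : ℕ → ℝ≥0∞) (hf : ∀ i, f i ≠ ∞) (n : ℕ) :
    infoContent (∏ i ∈ Finset.range n, f i) ≤ ∑ i ∈ Finset.range n, infoContent (f i) := by
  induction n with
  | zero => simp [infoContent]
  | succ n ih =>
    rw [Finset.prod_range_succ, Finset.sum_range_succ]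
    exact (infoContent_mul_le (ENNReal.prod_ne_top fun i _ => hf i) (hf n)).trans (by gcongr)

lemma infoContent_mul_self {t : ℝ≥0∞} (ht : t ≠ ∞) :
    infoContent t * t = ENNReal.ofReal (negMulLog t.toReal) := by
  rcases eq_or_ne t 0 with rfl | h0
  · simp
  · rw [infoContent_eq h0 ht, negMulLog, neg_mul_comm, mul_comm,
      ENNReal.ofReal_mul ENNReal.toReal_nonneg, ENNReal.ofReal_toReal ht]

lemma negMulLog_add_le {a b : ℝ} (ha : 0 ≤ a) (hb : 0 ≤ b) :
    negMulLog (a + b) ≤ negMulLog a + negMulLog b := by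
  rcases ha.eq_or_lt with rfl | ha
  · simp
  rcases hb.eq_or_lt with rfl | hb
  · simp
  have h1 : Real.log a ≤ Real.log (a + b) := Real.log_le_log ha (by linarith)
  have h2 : Real.log b ≤ Real.log (a + b) := Real.log_le_log hb (by linarith)
  simp only [negMulLog]
  nlinarith

lemma negMulLog_le_negMulLog_add {a b : ℝ} (ha : 0 ≤ a) (hb : 0 ≤ b) (hab : a + b ≤ 1) :
    negMulLog a ≤ negMulLog (a + b) + b := by
  rcases ha.eq_or_lt with rfl | ha
  · simpa using add_nonneg (negMulLog_nonneg hb (by linarith)) hb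
  have h1 : Real.log ((a + b) / a) ≤ (a + b) / a - 1 := Real.log_le_sub_one_of_pos (by positivity)
  rw [Real.log_div (by positivity) ha.ne'] at h1
  have h2 : a * (Real.log (a + b) - Real.log a) ≤ b := by
    calc _ ≤ a * ((a + b) / a - 1) := by gcongr
      _ = b := by field_simp; ring
  have h3 : Real.log (a + b) ≤ 0 := Real.log_nonpos (by positivity) hab
  simp only [negMulLog]
  nlinarith

/-- Continuity of entropy along `a n + q n`, where `a n` is dominated by its limit `p`, which has
finite entropy, and the mass and the entropy of `q n` tend to zero. -/
lemma tendsto_tsum_negMulLog {α : Type*} {p : α → ℝ} {a q : ℕ → α → ℝ}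
    (hp1 : ∀ g, p g ≤ 1) (ha : ∀ n g, 0 ≤ a n g) (hq : ∀ n g, 0 ≤ q n g)
    (hap : ∀ n g, a n g ≤ p g) (haq : ∀ n g, a n g + q n g ≤ 1)
    (hps : Summable p) (hpη : Summable fun g => negMulLog (p g))
    (hlim : ∀ g, Tendsto (fun n => a n g) atTop (𝓝 (p g)))
    (hqs : ∀ n, Summable (q n)) (hqη : ∀ n, Summable fun g => negMulLog (q n g))
    (hq0 : Tendsto (fun n => ∑' g, q n g) atTop (𝓝 0))
    (hqη0 : Tendsto (fun n => ∑' g, negMulLog (q n g)) atTop (𝓝 0)) :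
    Tendsto (fun n => ∑' g, negMulLog (a n g + q n g)) atTop (𝓝 (∑' g, negMulLog (p g))) := by
  have hη (n g) : 0 ≤ negMulLog (a n g) :=
    negMulLog_nonneg (ha n g) ((hap n g).trans (hp1 g))
  have hqη' (n g) : 0 ≤ negMulLog (q n g) :=
    negMulLog_nonneg (hq n g) (by linarith [ha n g, haq n g])
  have hbound (n g) : negMulLog (a n g) ≤ negMulLog (p g) + p g := by
    have := negMulLog_le_negMulLog_add (ha n g) (sub_nonneg.2 (hap n g))
      (by simpa using hp1 g)
    rw [add_sub_cancel] at this
    linarith [ha n g]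
  have hbs : Summable fun g => negMulLog (p g) + p g := hpη.add hps
  have h1 : Tendsto (fun n => ∑' g, negMulLog (a n g)) atTop (𝓝 (∑' g, negMulLog (p g))) :=
    tendsto_tsum_of_dominated_convergence hbs
      (fun g => (continuous_negMulLog.tendsto _).comp (hlim g))
      (.of_forall fun n g => by rw [Real.norm_of_nonneg (hη n g)]; exact hbound n g)
  have has (n) : Summable fun g => negMulLog (a n g) :=
    Summable.of_nonneg_of_le (hη n) (hbound n) hbs
  have hdiff (n g) : ‖negMulLog (a n g + q n g) - negMulLog (a n g)‖ ≤
      negMulLog (q n g) + q n g := by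
    rw [Real.norm_eq_abs, abs_le]
    constructor
    · linarith [negMulLog_le_negMulLog_add (ha n g) (hq n g) (haq n g), hqη' n g]
    · linarith [negMulLog_add_le (ha n g) (hq n g), hq n g]
  have hds (n) : Summable fun g => negMulLog (q n g) + q n g := (hqη n).add (hqs n)
  have h2 : Tendsto (fun n => ∑' g, (negMulLog (a n g + q n g) - negMulLog (a n g))) atTop
      (𝓝 0) := by
    refine squeeze_zero_norm (fun n => tsum_of_norm_bounded (hds n).hasSum (hdiff n)) ?_
    simpa [(hqη _).tsum_add (hqs _)] using hqη0.add hq0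
  have h3 := h1.add h2
  rw [add_zero] at h3
  refine h3.congr fun n => ?_
  rw [← (has n).tsum_add (Summable.of_norm_bounded (hds n) (hdiff n))]
  simp

lemma fent_eq_tsum_negMulLog {G : Type*} (f : G → ℝ≥0∞) :
    fent f = ∑' g, negMulLog (f g).toReal := by
  simp [fent, negMulLog, tsum_neg]

lemma rwPos_succ {G : Type*} [Group G] (ω : ℕ → G) (n : ℕ) :
    rwPos ω (n + 1) = rwPos ω n * ω n := by
  simp [rwPos, List.range_succ]

lemma rwPos_congr {G : Type*} [Group G] {ω ω' : ℕ → G} {n : ℕ} (h : ∀ i < n, ω' i = ω i) :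
    rwPos ω' n = rwPos ω n := by
  simp only [rwPos]
  congr 1
  exact List.map_congr_left fun i hi => h i (List.mem_range.1 hi)

lemma measurable_rwPos {G : Type*} [Group G] [Countable G] [MeasurableSpace G]
    [DiscreteMeasurableSpace G] (n : ℕ) : Measurable fun ω : ℕ → G => rwPos ω n := by
  induction n with
  | zero => simp [rwPos]
  | succ n ih =>
    simp only [rwPos_succ]
    exact (Measurable.of_discrete (f := fun x : G × G => x.1 * x.2)).comp
      (ih.prodMk (measurable_pi_apply n))

namespace IsMST

variable {G : Type*} [Group G] [MeasurableSpace G] {τ : (ℕ → G) → ℕ}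

lemma eq_of_agree (hτ : IsMST τ) {ω ω' : ℕ → G} (h : ∀ i < τ ω, ω' i = ω i) :
    τ ω' = τ ω := by
  obtain ⟨B, -, hB⟩ := hτ (τ ω)
  have key : (fun i : Fin (τ ω + 1) => rwPos ω' (i : ℕ)) =
      fun i : Fin (τ ω + 1) => rwPos ω (i : ℕ) := by
    funext i
    exact rwPos_congr fun j hj => h j (by omega)
  have hω : ω ∈ {ω₁ | τ ω₁ = τ ω} := rfl
  rw [← hB, Set.mem_preimage, ← key] at hω
  exact hB.subset hω

lemma lt_of_agree (hτ : IsMST τ) {ω ω' : ℕ → G} {n : ℕ} (h : ∀ i < n, ω' i = ω i)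
    (hn : n < τ ω) : n < τ ω' := by
  by_contra! hle
  have := hτ.eq_of_agree (ω := ω') (ω' := ω) fun i hi => (h i (by omega)).symm
  omega

lemma measurable [Countable G] [DiscreteMeasurableSpace G] (hτ : IsMST τ) : Measurable τ := by
  refine measurable_to_countable' fun s => ?_
  obtain ⟨B, hB, h⟩ := hτ s
  have : τ ⁻¹' {s} = (fun ω (i : Fin (s + 1)) => rwPos ω (i : ℕ)) ⁻¹' B := h.symm
  rw [this]
  exact measurable_pi_lambda _ (fun i => measurable_rwPos _) hB

lemma measurable_rwPos [Countable G] [DiscreteMeasurableSpace G] (hτ : IsMST τ) :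
    Measurable fun ω => rwPos ω (τ ω) :=
  (measurable_from_prod_countable_right (f := fun x : ℕ × (ℕ → G) => rwPos x.2 x.1)
    _root_.measurable_rwPos).comp (hτ.measurable.prodMk measurable_id)

end IsMST

lemma tsum_mul_measure_inter_fiber {Ω G : Type*} [MeasurableSpace Ω] [MeasurableSpace G]
    [Countable G] [DiscreteMeasurableSpace G] (P : Measure Ω) {Y : Ω → G} (hY : Measurable Y)
    (E : Set Ω) (f : G → ℝ≥0∞) :
    ∑' g, f g * P ({ω | Y ω = g} ∩ E) = ∫⁻ ω in E, f (Y ω) ∂P := by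
  rw [← lintegral_map (f := f) .of_discrete hY, lintegral_countable']
  refine tsum_congr fun g => ?_
  rw [Measure.map_apply hY (measurableSet_singleton g),
    Measure.restrict_apply (hY (measurableSet_singleton g))]
  rfl

section Walk

variable {G : Type*} [Countable G] [MeasurableSpace G] [DiscreteMeasurableSpace G]
  {μf : G → ℝ≥0∞} {P : Measure (ℕ → G)}

/-- The entropy of a variable `Y` on an event `E` is at most the mean information content of an
initial word of increments which determines both. -/
lemma tsum_entropy_le [IsProbabilityMeasure P] (hμ : ∀ g, μf g ≠ ∞)
    (hP : ∀ (n : ℕ) (g : ℕ → G),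
      P {ω | ∀ i < n, ω i = g i} = ∏ i ∈ Finset.range n, μf (g i))
    {Y : (ℕ → G) → G} (hY : Measurable Y) {E : Set (ℕ → G)} (hE : MeasurableSet E)
    (N : (ℕ → G) → ℕ)
    (h : ∀ ω ∈ E, ∀ ω', (∀ i < N ω, ω' i = ω i) → ω' ∈ E ∧ Y ω' = Y ω) :
    ∑' g, ENNReal.ofReal (negMulLog (P ({ω | Y ω = g} ∩ E)).toReal) ≤
      ∫⁻ ω in E, ∑ i ∈ Finset.range (N ω), infoContent (μf (ω i)) ∂P := by
  simp only [← infoContent_mul_self (measure_ne_top P _)]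
  rw [tsum_mul_measure_inter_fiber P hY E fun g => infoContent (P ({ω | Y ω = g} ∩ E))]
  refine setLIntegral_mono' hE fun ω hω => ?_
  refine le_trans (infoContent_anti ?_) (infoContent_prod_le _ (fun i => hμ (ω i)) (N ω))
  rw [← hP]
  exact measure_mono fun ω' hω' => (h ω hω ω' hω').symm

/-- An event depending only on the first `n` increments is independent of the next increment. -/
lemma measure_increment_inter [IsProbabilityMeasure P]
    (hP : ∀ (n : ℕ) (g : ℕ → G),
      P {ω | ∀ i < n, ω i = g i} = ∏ i ∈ Finset.range n, μf (g i))
    {n : ℕ} {A : Set (ℕ → G)} (hA : ∀ ω ∈ A, ∀ ω', (∀ i < n, ω' i = ω i) → ω' ∈ A) (g : G) :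
    P ({ω | ω n = g} ∩ A) = μf g * P A := by
  classical
  let ρ : (ℕ → G) → Fin n → G := fun ω i => ω i
  have hρ : Measurable ρ := measurable_pi_lambda _ fun i => measurable_pi_apply _
  have hmeas : (P.restrict {ω | ω n = g}).map ρ = μf g • P.map ρ := by
    refine Measure.ext_of_singleton fun b => ?_
    let w : ℕ → G := fun i => if h : i < n then b ⟨i, h⟩ else g
    have h1 : ρ ⁻¹' {b} = {ω | ∀ i < n, ω i = w i} := by
      ext ω
      simp only [Set.mem_preimage, Set.mem_singleton_iff, funext_iff, Fin.forall_iff,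
        Set.mem_ofPred_eq, ρ]
      exact forall₂_congr fun i hi => by simp [w, hi]
    have h2 : ρ ⁻¹' {b} ∩ {ω | ω n = g} = {ω | ∀ i < n + 1, ω i = w i} := by
      rw [h1]
      ext ω
      simp only [Set.mem_inter_iff, Set.mem_ofPred_eq, Nat.forall_lt_succ_right]
      simp [w]
    rw [Measure.map_apply hρ (measurableSet_singleton b),
      Measure.restrict_apply (hρ (measurableSet_singleton b)), h2, Measure.smul_apply,
      Measure.map_apply hρ (measurableSet_singleton b), h1, hP, hP, Finset.prod_range_succ]
    simp [w, mul_comm]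
  have hAρ : A = ρ ⁻¹' (ρ '' A) := by
    refine (Set.subset_preimage_image ρ A).antisymm ?_
    rintro ω' ⟨ω, hω, heq⟩
    exact hA ω hω ω' fun i hi => (congrFun heq ⟨i, hi⟩).symm
  have hB : MeasurableSet (ρ '' A) := .of_discrete
  have := congrArg (fun m => m (ρ '' A)) hmeas
  simp only [Measure.smul_apply, smul_eq_mul] at this
  rwa [Measure.map_apply hρ hB, Measure.restrict_apply (hρ hB), Measure.map_apply hρ hB, ← hAρ,
    Set.inter_comm] at this

lemma sum_range_eq_tsum_ite (m : ℕ) (f : ℕ → ℝ≥0∞) :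
    ∑ i ∈ Finset.range m, f i = ∑' i, if i < m then f i else 0 := by
  rw [tsum_eq_sum (s := Finset.range m) (by simp +contextual)]
  exact Finset.sum_congr rfl fun i hi => by simp [Finset.mem_range.1 hi]

lemma lintegral_sum_range {Ω : Type*} [MeasurableSpace Ω] {Q : Measure Ω} {τ : Ω → ℕ}
    (hτ : Measurable τ) {f : ℕ → Ω → ℝ≥0∞} (hf : ∀ i, Measurable (f i)) :
    ∫⁻ ω, ∑ i ∈ Finset.range (τ ω), f i ω ∂Q = ∑' i, ∫⁻ ω in {ω | i < τ ω}, f i ω ∂Q := by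
  have hm (i : ℕ) : MeasurableSet {ω | i < τ ω} := hτ measurableSet_Ioi
  simp only [sum_range_eq_tsum_ite]
  rw [lintegral_tsum fun i => (Measurable.ite (hm i) (hf i) measurable_const).aemeasurable]
  refine tsum_congr fun i => ?_
  rw [← lintegral_indicator (hm i)]
  simp only [Set.indicator_apply, Set.mem_ofPred_eq]

lemma tsum_measure_lt {Ω : Type*} [MeasurableSpace Ω] (Q : Measure Ω) {τ : Ω → ℕ}
    (hτ : Measurable τ) : ∑' i, Q {ω | i < τ ω} = ∫⁻ ω, τ ω ∂Q := by
  simpa using (lintegral_sum_range (Q := Q) hτ (f := fun _ _ => 1) fun _ => measurable_const).symm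

/-- Wald's identity for functionals of the increments. -/
lemma lintegral_sum_increments [Group G] [IsProbabilityMeasure P]
    (hP : ∀ (n : ℕ) (g : ℕ → G),
      P {ω | ∀ i < n, ω i = g i} = ∏ i ∈ Finset.range n, μf (g i))
    {τ : (ℕ → G) → ℕ} (hτ : IsMST τ) (f : G → ℝ≥0∞) :
    ∫⁻ ω, ∑ i ∈ Finset.range (τ ω), f (ω i) ∂P = (∑' g, f g * μf g) * ∫⁻ ω, τ ω ∂P := by
  rw [lintegral_sum_range hτ.measurable (f := fun i ω => f (ω i)) fun i =>
    (Measurable.of_discrete (f := f)).comp (measurable_pi_apply i),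
    ← tsum_measure_lt P hτ.measurable, ← ENNReal.tsum_mul_left]
  refine tsum_congr fun i => ?_
  rw [← tsum_mul_measure_inter_fiber P (measurable_pi_apply i), ← ENNReal.tsum_mul_right]
  refine tsum_congr fun g => ?_
  rw [measure_increment_inter hP (A := {ω | i < τ ω}) (fun ω hω ω' h => hτ.lt_of_agree h hω) g,
    mul_assoc]

end Walk

/-- For a Markov stopping time `τ` with finite expectation,
`H(μ_{τ ∧ n}) → H(μ_τ)` as `n → ∞`. -/
theorem entropy_of_truncated_stopped_distribution_tendsto
    {G : Type*} [Group G] [Countable G] [MeasurableSpace G] [DiscreteMeasurableSpace G]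
    (μf : G → ℝ≥0∞) (hprob : ∑' g : G, μf g = 1)
    (hent : Summable fun g : G => (μf g).toReal * Real.log (μf g).toReal)
    (P : Measure (ℕ → G)) [IsProbabilityMeasure P]
    (hP : ∀ (n : ℕ) (g : ℕ → G),
      P {ω | ∀ i < n, ω i = g i} = ∏ i ∈ Finset.range n, μf (g i))
    (τ : (ℕ → G) → ℕ) (hτ : IsMST τ)
    (hτfin : ∫⁻ ω, (τ ω : ℝ≥0∞) ∂P ≠ ∞) :
    Tendsto (fun n : ℕ => fent (fun g : G => P {ω | rwPos ω (min (τ ω) n) = g})) atTop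
      (𝓝 (fent (fun g : G => P {ω | rwPos ω (τ ω) = g}))) := by
  have hμ1 (g : G) : μf g ≤ 1 := hprob ▸ ENNReal.le_tsum g
  have hμ (g : G) : μf g ≠ ∞ := ne_top_of_le_ne_top one_ne_top (hμ1 g)
  have hm : Measurable τ := hτ.measurable
  have hX : Measurable fun ω => rwPos ω (τ ω) := hτ.measurable_rwPos
  let S : (ℕ → G) → ℝ≥0∞ := fun ω => ∑ i ∈ Finset.range (τ ω), infoContent (μf (ω i))
  have hS : ∫⁻ ω, S ω ∂P ≠ ∞ := by
    rw [lintegral_sum_increments hP hτ fun g => infoContent (μf g)]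
    refine ENNReal.mul_ne_top ?_ hτfin
    simp only [infoContent_mul_self (hμ _)]
    refine Summable.tsum_ofReal_ne_top ?_
    simpa [negMulLog] using hent.neg
  have htail : Tendsto (fun n => P {ω | n < τ ω}) atTop (𝓝 0) :=
    ENNReal.tendsto_atTop_zero_of_tsum_ne_top (by rwa [tsum_measure_lt P hm])
  have hmass (Y : (ℕ → G) → G) (hY : Measurable Y) (E : Set (ℕ → G)) :
      ∑' g, P ({ω | Y ω = g} ∩ E) = P E := by
    simpa using tsum_mul_measure_inter_fiber P hY E fun _ => 1
  have hle_one (A : Set (ℕ → G)) : (P A).toReal ≤ 1 := measureReal_le_one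
  have hsummable (f : G → ℝ) (hf : ∀ g, 0 ≤ f g) (h : ∑' g, ENNReal.ofReal (f g) ≠ ∞) :
      Summable f := by
    simpa [ENNReal.toReal_ofReal (hf _)] using ENNReal.summable_toReal h
  let p : G → ℝ := fun g => (P {ω | rwPos ω (τ ω) = g}).toReal
  let a : ℕ → G → ℝ := fun n g => (P ({ω | rwPos ω (τ ω) = g} ∩ {ω | τ ω ≤ n})).toReal
  let q : ℕ → G → ℝ := fun n g => (P ({ω | rwPos ω n = g} ∩ {ω | n < τ ω})).toReal
  have hη (A : Set (ℕ → G)) : 0 ≤ negMulLog (P A).toReal :=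
    negMulLog_nonneg ENNReal.toReal_nonneg (hle_one A)
  have hdecomp (n : ℕ) (g : G) : (P {ω | rwPos ω (min (τ ω) n) = g}).toReal = a n g + q n g := by
    have hlt : MeasurableSet {ω | n < τ ω} := hm measurableSet_Ioi
    rw [← measureReal_def, ← measureReal_sdiff_add_inter hlt]
    simp only [a, q, ← measureReal_def]
    congr 2
    · ext ω
      simp only [Set.mem_sdiff, Set.mem_inter_iff, Set.mem_ofPred_eq, not_lt]
      exact and_congr_left fun h => by rw [min_eq_left h]
    · ext ω
      simp only [Set.mem_inter_iff, Set.mem_ofPred_eq]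
      exact and_congr_left fun h => by rw [min_eq_right h.le]
  have hqη_le (n : ℕ) : ∑' g, ENNReal.ofReal (negMulLog (q n g)) ≤
      ∫⁻ ω in {ω | n < τ ω}, S ω ∂P := by
    refine (tsum_entropy_le hμ hP (measurable_rwPos n) (hm measurableSet_Ioi) (fun _ => n)
      fun ω hω ω' h => ⟨hτ.lt_of_agree h hω, rwPos_congr h⟩).trans ?_
    exact setLIntegral_mono' (hm measurableSet_Ioi) fun ω hω =>
      Finset.sum_le_sum_of_subset (Finset.range_mono (le_of_lt hω))
  have hpη : ∑' g, ENNReal.ofReal (negMulLog (p g)) ≤ ∫⁻ ω, S ω ∂P := by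
    simpa [p, S] using tsum_entropy_le hμ hP hX .univ τ fun ω _ ω' h => by
      have := hτ.eq_of_agree h
      exact ⟨trivial, by rw [this]; exact rwPos_congr h⟩
  have hqs (n : ℕ) : ∑' g, P ({ω | rwPos ω n = g} ∩ {ω | n < τ ω}) ≠ ∞ := by
    rw [hmass _ (measurable_rwPos n)]
    exact measure_ne_top _ _
  have hqη (n : ℕ) : ∑' g, ENNReal.ofReal (negMulLog (q n g)) ≠ ∞ :=
    ne_top_of_le_ne_top hS ((hqη_le n).trans (setLIntegral_le_lintegral _ _))
  simp only [fent_eq_tsum_negMulLog, hdecomp]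
  refine tendsto_tsum_negMulLog (p := p) (fun g => hle_one _) (fun _ _ => ENNReal.toReal_nonneg)
    (fun _ _ => ENNReal.toReal_nonneg)
    (fun n g => ENNReal.toReal_mono (measure_ne_top _ _) (measure_mono Set.inter_subset_left))
    (fun n g => hdecomp n g ▸ hle_one _) (ENNReal.summable_toReal ?_)
    (hsummable _ (fun g => hη _) (ne_top_of_le_ne_top hS hpη)) (fun g => ?_)
    (fun n => ENNReal.summable_toReal (hqs n)) (fun n => hsummable _ (fun g => hη _) (hqη n)) ?_ ?_
  · have := hmass _ hX Set.univ
    simp only [Set.inter_univ, measure_univ] at this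
    simp [this]
  · refine (ENNReal.tendsto_toReal (measure_ne_top _ _)).comp ?_
    have hmono : Monotone fun n => {ω | rwPos ω (τ ω) = g} ∩ {ω | τ ω ≤ n} :=
      fun m n hmn => Set.inter_subset_inter_right _ fun ω hω => le_trans hω hmn
    have hunion : ⋃ n, {ω | rwPos ω (τ ω) = g} ∩ {ω | τ ω ≤ n} = {ω | rwPos ω (τ ω) = g} := by
      ext ω
      simpa using fun _ => ⟨τ ω, le_rfl⟩
    have hcont := tendsto_measure_iUnion_atTop (μ := P) hmono
    rwa [hunion] at hcont
  · simp only [q, ← ENNReal.tsum_toReal_eq fun g => measure_ne_top P _,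
      hmass _ (measurable_rwPos _)]
    exact (ENNReal.tendsto_toReal zero_ne_top).comp htail
  · have hlim : Tendsto (fun n => ∑' g, ENNReal.ofReal (negMulLog (q n g))) atTop (𝓝 0) :=
      tendsto_of_tendsto_of_tendsto_of_le_of_le tendsto_const_nhds
        (tendsto_setLIntegral_zero hS htail) (fun _ => zero_le) hqη_le
    refine ((ENNReal.tendsto_toReal zero_ne_top).comp hlim).congr fun n => ?_
    rw [Function.comp_apply, ENNReal.tsum_toReal_eq fun g => ofReal_ne_top]
    exact tsum_congr fun g => ENNReal.toReal_ofReal (hη _)
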